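/- arXiv:2109.10705 — 2 statements merged into one kernel-verified Lean document; each statement's English description precedes it below -/
import Mathlib

section
/- For every positive integer n, cf(n) ≤ 4·⌈n/20⌉; that is, for every n there exists a set of n points in the plane in general position whose largest crossing family has size at most 4·⌈n/20⌉. -/
/-- A finite set of points in the plane is in *general position* if no three of
its points are collinear. -/
def GenPos (S : Finset (ℝ × ℝ)) : Prop :=
  ∀ p ∈ S, ∀ q ∈ S, ∀ r ∈ S, p ≠ q → p ≠ r → q ≠ r →
    ¬Collinear ℝ ({p, q, r} : Set (ℝ × ℝ))

/-- Two closed segments `pq` and `rs` *cross* if they intersect in exactly one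
point, which lies in the interior of both segments. -/
def Crosses (p q r s : ℝ × ℝ) : Prop :=
  ∃ x : ℝ × ℝ, x ∈ openSegment ℝ p q ∧ x ∈ openSegment ℝ r s ∧
    segment ℝ p q ∩ segment ℝ r s = {x}

/-- `F` is a *crossing family* in `S`: a finite set of segments (given by their
pairs of distinct endpoints, which belong to `S`) that pairwise cross. -/
def IsCrossingFamily (S : Finset (ℝ × ℝ)) (F : Finset ((ℝ × ℝ) × (ℝ × ℝ))) : Prop :=
  (∀ e ∈ F, e.1 ∈ S ∧ e.2 ∈ S ∧ e.1 ≠ e.2) ∧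
  (∀ e ∈ F, ∀ f ∈ F, e ≠ f → Crosses e.1 e.2 f.1 f.2)

/-- `S` contains a `k`-crossing family. -/
def HasCrossingFamily (S : Finset (ℝ × ℝ)) (k : ℕ) : Prop :=
  ∃ F : Finset ((ℝ × ℝ) × (ℝ × ℝ)), IsCrossingFamily S F ∧ F.card = k

/-- `cf S`: the maximum size of a crossing family in `S`. -/
noncomputable def cf (S : Finset (ℝ × ℝ)) : ℕ :=
  sSup {k : ℕ | HasCrossingFamily S k}

/-- `cfNat n`: the minimum of `cf S` over all sets `S` of `n` points in
general position. -/
noncomputable def cfNat (n : ℕ) : ℕ :=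
  sInf {m : ℕ | ∃ S : Finset (ℝ × ℝ), S.card = n ∧ GenPos S ∧ cf S = m}

/-- `p a L'` holds for every tail `a :: L'` of the list. -/
def everyTail {α : Type*} (p : α → List α → Bool) : List α → Bool
  | [] => true
  | a :: L => p a L && everyTail p L

/-- A search confirming that a list has no `k` entries that are pairwise related by `r`. -/
def noClique {α : Type*} (r : α → α → Bool) : ℕ → List α → Bool
  | 0 => fun _ => false
  | k + 1 => everyTail fun a L => noClique r k (L.filter (r a))

theorem length_ne_of_everyTail {α : Type*} {r : α → α → Bool} {k : ℕ}
    {p : α → List α → Bool}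
    (hp : ∀ a L, p a L = true →
      ∀ L' : List α, L'.Sublist (L.filter (r a)) → L'.Pairwise (r · ·) → L'.length ≠ k) :
    ∀ L, everyTail p L = true →
      ∀ L' : List α, L'.Sublist L → L'.Pairwise (r · ·) → L'.length ≠ k + 1
  | [], _, L', hs, _ => by simp [List.sublist_nil.1 hs]
  | a :: L, h, L', hs, hL' => by
    rw [everyTail, Bool.and_eq_true] at h
    cases hs with
    | cons _ hs => exact length_ne_of_everyTail hp L h.2 L' hs hL'
    | cons_cons _ hs =>
      rename_i L₁
      rw [List.pairwise_cons] at hL'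
      have hs' : L₁.Sublist (L.filter (r a)) := by
        rw [← List.filter_eq_self.2 hL'.1]
        exact hs.filter _
      simpa using hp a L h.1 L₁ hs' hL'.2

theorem length_ne_of_noClique {α : Type*} {r : α → α → Bool} :
    ∀ (k : ℕ) (L : List α), noClique r k L = true →
      ∀ L' : List α, L'.Sublist L → L'.Pairwise (r · ·) → L'.length ≠ k
  | 0, _, h => by simp [noClique] at h
  | k + 1, L, h => length_ne_of_everyTail
      (p := fun a L => noClique r k (L.filter (r a)))
      (fun _ _ h => length_ne_of_noClique k _ h) L h

/-- Whether two segments without common endpoints, according to their bit masks, each separate the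
endpoints of the other. -/
def maskCross (e f : ℕ × ℕ × ℕ) : Bool :=
  (e.2.2.testBit f.1 ^^ e.2.2.testBit f.2.1) && (f.2.2.testBit e.1 ^^ f.2.2.testBit e.2.1) &&
    (e.1 != f.1 && e.1 != f.2.1 && e.2.1 != f.1 && e.2.1 != f.2.1)

/-- Twice the signed area of the triangle with vertices `i`, `j`, `k`. -/
def tri {ι : Type*} (X Y : ι → ℤ) (i j k : ι) : ℤ :=
  (X j - X i) * (Y k - Y i) - (Y j - Y i) * (X k - X i)

theorem not_forall_of_noClique {α : Type*} [DecidableEq α] {r : α → α → Bool} {k : ℕ} {L : List α}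
    (h : noClique r k L = true) (hL : L.Nodup) (e : Fin k → α) (he : Function.Injective e)
    (hmem : ∀ a, e a ∈ L) (hr : ∀ a b, a ≠ b → r (e a) (e b) = true) : False := by
  refine length_ne_of_noClique k L h (L.filter (· ∈ Finset.univ.image e)) List.filter_sublist ?_ ?_
  · refine (hL.filter _).imp_of_mem ?_
    intro x y hx hy hxy
    simp only [List.mem_filter, Finset.mem_image, Finset.mem_univ, true_and, decide_eq_true_eq]
      at hx hy
    obtain ⟨-, a, rfl⟩ := hx
    obtain ⟨-, b, rfl⟩ := hy
    exact hr a b fun hab => hxy (congrArg e hab)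
  · have hset : (L.filter (· ∈ Finset.univ.image e)).toFinset = Finset.univ.image e := by
      ext x
      simp only [List.mem_toFinset, List.mem_filter, decide_eq_true_eq, and_iff_right_iff_imp,
        Finset.mem_image, Finset.mem_univ, true_and]
      rintro ⟨a, rfl⟩
      exact hmem a
    rw [← List.toFinset_card_of_nodup (hL.filter _), hset, Finset.card_image_of_injective _ he,
      Finset.card_univ, Fintype.card_fin]

/-- The points `i`, `j` lie on different sides of the line through `k`, `l`, and conversely. -/
def IntCross {ι : Type*} (X Y : ι → ℤ) (i j k l : ι) : Prop :=
  tri X Y i j k * tri X Y i j l < 0 ∧ tri X Y k l i * tri X Y k l j < 0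

/-- The abscissae of a set of twenty points without five pairwise crossing segments. -/
def xs : List ℤ := [302, 306, 314, 350, 369, 487, 428, 321, 576, 485, 424, 361, 789, 782, 882, 894, 183, 181, 78, 4]

/-- The ordinates of a set of twenty points without five pairwise crossing segments. -/
def ys : List ℤ := [60, 73, 200, 249, 393, 498, 503, 508, 572, 578, 584, 591, 631, 632, 707, 711, 774, 784, 819, 857]

/-- The segments `(i, j, m)` of the point set with coordinates `xs` and `ys`, where `i < j` and `m`
is the bit mask of the points to the left of the ray from point `i` through point `j`. -/
def segments : List (ℕ × ℕ × ℕ) :=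
  [(0, 1, 986332), (0, 15, 1015806), (0, 19, 0), (9, 10, 255), (12, 13, 4095), (14, 15, 986624),
   (15, 19, 491519), (16, 17, 786435), (18, 19, 3839), (17, 18, 69631), (16, 18, 4095),
   (4, 7, 983055), (5, 8, 986816), (7, 11, 983040), (8, 9, 255), (10, 11, 255), (12, 15, 1011696),
   (17, 19, 331775), (0, 2, 983168), (1, 2, 983169), (1, 3, 986261), (4, 6, 986240), (5, 6, 159),
   (15, 18, 229375), (14, 19, 475135), (15, 17, 98303), (16, 19, 266239), (0, 12, 995326),
   (1, 15, 1015804), (2, 3, 987120), (12, 14, 995312), (3, 4, 985223), (14, 18, 212991),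
   (0, 14, 999422), (13, 15, 1003504), (1, 12, 995324), (2, 4, 985216), (2, 7, 983043), (2, 19, 3),
   (14, 17, 81919), (0, 18, 524288), (1, 19, 1), (13, 14, 987120), (3, 5, 986836), (5, 9, 986335),
   (6, 7, 63), (8, 13, 1035904), (0, 3, 986260), (1, 14, 999420), (3, 6, 986260), (3, 12, 995312),
   (4, 5, 986816), (6, 8, 986752), (6, 9, 986240), (6, 10, 985247), (4, 11, 983183),
   (5, 12, 1044416), (0, 13, 987134), (3, 15, 1015792), (6, 11, 983199), (8, 12, 1044096),
   (5, 13, 1036224), (1, 13, 987132), (7, 10, 985088), (8, 10, 767), (9, 11, 1279),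
   (11, 16, 786655), (0, 5, 986846), (2, 15, 1015800), (1, 5, 986844), (3, 13, 987120),
   (2, 12, 995320), (3, 14, 999408), (0, 8, 986878), (1, 8, 986876), (0, 7, 983040),
   (2, 18, 524291), (7, 19, 31), (1, 18, 524289), (1, 6, 986269), (3, 8, 986868), (4, 12, 1044448),
   (1, 7, 983041), (2, 13, 987128), (1, 4, 985221), (2, 14, 999416), (0, 4, 985220),
   (0, 6, 986268), (3, 7, 983047), (4, 19, 15), (5, 7, 31), (2, 6, 986256), (3, 19, 7),
   (0, 17, 786432), (7, 18, 524319), (2, 16, 786435), (0, 16, 917504), (4, 18, 524303),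
   (11, 19, 223), (1, 16, 917505), (11, 18, 524511), (1, 17, 786433), (7, 16, 786463),
   (3, 18, 524295), (2, 11, 983168), (2, 5, 986832), (4, 8, 986848), (4, 13, 1036256),
   (4, 10, 985216), (4, 16, 786447), (5, 10, 985311), (6, 12, 1044352), (10, 17, 854271),
   (15, 16, 32767), (9, 17, 855295), (11, 17, 852191), (10, 16, 788735), (10, 18, 526591),
   (0, 9, 986334), (0, 11, 983172), (7, 9, 986112), (3, 11, 983175), (2, 8, 986864),
   (1, 9, 986332), (1, 11, 983173), (3, 16, 786439), (6, 19, 159), (2, 17, 851971), (10, 19, 2303),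
   (4, 17, 851983), (6, 18, 524447), (7, 17, 851999), (14, 16, 16383), (7, 8, 1048064),
   (3, 9, 986324), (5, 11, 223), (2, 10, 985232), (3, 10, 985239), (4, 9, 986304),
   (6, 13, 1036160), (6, 16, 786591), (0, 10, 985236), (1, 10, 985237), (3, 17, 851975),
   (2, 9, 986320), (5, 19, 2271), (9, 18, 527615), (5, 18, 526559), (6, 17, 852127), (9, 19, 3327),
   (9, 16, 789759), (5, 16, 788703), (8, 11, 1791), (7, 12, 1043968), (11, 15, 983040),
   (5, 17, 854239), (8, 16, 790271), (11, 14, 1015808), (8, 18, 3839), (10, 15, 985088),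
   (7, 13, 1035776), (9, 12, 1043456), (8, 17, 855807), (8, 19, 265983), (10, 14, 1017856),
   (9, 13, 1035264), (4, 15, 1003488), (10, 12, 1042432), (7, 14, 986624), (11, 13, 1032192),
   (9, 14, 1018880), (12, 19, 471039), (9, 15, 986112), (13, 16, 4095), (5, 15, 1003456),
   (10, 13, 1034240), (11, 12, 1040384), (8, 14, 986752), (12, 18, 208895), (6, 14, 987008),
   (13, 17, 69631), (6, 15, 1003392), (4, 14, 987104), (7, 15, 1003008), (12, 16, 12287),
   (13, 18, 200703), (5, 14, 987072), (8, 15, 1003136), (12, 17, 77823), (13, 19, 462847)]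

theorem noClique_segments : noClique maskCross 5 segments = true := by
  decide +kernel

theorem nodup_segments : segments.Nodup := by
  decide +kernel

theorem testBit_segments : ∀ e ∈ segments, ∀ k : Fin 20,
    e.2.2.testBit k = decide (0 < tri (xs.getD · 0) (ys.getD · 0) e.1 e.2.1 k) := by
  decide +kernel

theorem exists_mem_segments : ∀ i j : Fin 20, i < j →
    ∃ e ∈ segments, e.1 = i ∧ e.2.1 = j := by
  decide +kernel

theorem tri_xs_ys_ne_zero : ∀ i j k : Fin 20, i ≠ j → i ≠ k → j ≠ k →
    tri (fun i : Fin 20 => xs.getD i 0) (fun i : Fin 20 => ys.getD i 0) i j k ≠ 0 := by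
  decide +kernel

theorem strictMono_ys : StrictMono fun i : Fin 20 => ys.getD i 0 := by
  unfold StrictMono
  decide +kernel

theorem decide_pos_ne_of_mul_neg {a b : ℤ} (h : a * b < 0) :
    ¬decide (0 < a) = decide (0 < b) := by
  rcases mul_neg_iff.1 h with ⟨ha, hb⟩ | ⟨ha, hb⟩
  · simp [ha, hb.le]
  · simp [ha.le, hb]

theorem not_forall_intCross (l h : Fin 5 → Fin 20) (hlh : ∀ a, l a < h a)
    (hcross : ∀ a b, a ≠ b → IntCross (fun i : Fin 20 => xs.getD i 0)
      (fun i : Fin 20 => ys.getD i 0) (l a) (h a) (l b) (h b)) : False := by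
  choose e he he₁ he₂ using fun a => exists_mem_segments (l a) (h a) (hlh a)
  have hne : ∀ a b, a ≠ b → l a ≠ l b ∧ l a ≠ h b ∧ h a ≠ l b ∧ h a ≠ h b := by
    intro a b hab
    obtain ⟨h₁, -⟩ := hcross a b hab
    refine ⟨?_, ?_, ?_, ?_⟩ <;> intro heq <;> rw [← heq] at h₁ <;>
      simp [tri, mul_comm] at h₁
  refine not_forall_of_noClique noClique_segments nodup_segments e ?_ he ?_
  · intro a b hab
    by_contra hne'
    exact (hne a b hne').1 (Fin.ext (by rw [← he₁, ← he₁, hab]))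
  · intro a b hab
    obtain ⟨h₁, h₂, h₃, h₄⟩ := hne a b hab
    obtain ⟨hc₁, hc₂⟩ := hcross a b hab
    simp only [maskCross, he₁, he₂, testBit_segments _ (he _), Bool.and_eq_true, bne_iff_ne, ne_eq,
      Fin.val_inj]
    exact ⟨⟨decide_pos_ne_of_mul_neg hc₁, decide_pos_ne_of_mul_neg hc₂⟩, ⟨⟨h₁, h₂⟩, h₃⟩, h₄⟩

/-- Kőnig's theorem for a relation between two finite types. -/
theorem exists_matching_or_cover {α β : Type*} [Fintype α] (R : α → β → Prop) [Fintype β] (k : ℕ) :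
    (∃ (l : Fin (k + 1) → α) (h : Fin (k + 1) → β),
      Function.Injective l ∧ Function.Injective h ∧ ∀ a, R (l a) (h a)) ∨
    ∃ (A : Finset α) (B : Finset β), A.card + B.card ≤ k ∧ ∀ i j, R i j → i ∈ A ∨ j ∈ B := by
  classical
  by_cases hα : Fintype.card α ≤ k
  · exact .inr ⟨Finset.univ, ∅, by simpa using hα, by simp⟩
  push Not at hα
  set d := Fintype.card α - (k + 1) with hd
  let t : α → Finset (β ⊕ Fin d) := fun i => (Finset.univ.filter (R i)).disjSum Finset.univ
  by_cases hall : ∀ W : Finset α, W.card ≤ (W.biUnion t).card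
  · left
    obtain ⟨f, hf, hft⟩ := (Finset.all_card_le_biUnion_card_iff_exists_injective t).1 hall
    have hright : (Finset.univ.filter fun i => (f i).isRight).card ≤ d := by
      have : (Finset.univ.filter fun i => (f i).isRight).card ≤
          ((Finset.univ : Finset (Fin d)).map Function.Embedding.inr : Finset (β ⊕ Fin d)).card := by
        refine Finset.card_le_card_of_injOn f ?_ hf.injOn
        intro i hi
        obtain ⟨y, hy⟩ := Sum.isRight_iff.1 (Finset.mem_filter.1 hi).2
        simp [hy]
      simpa using this
    have hleft : k + 1 ≤ Fintype.card {i // (f i).isLeft} := by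
      have := Finset.card_filter_add_card_filter_not (s := (Finset.univ : Finset α))
        (fun i => (f i).isLeft = true)
      simp only [Bool.not_eq_true, Sum.isLeft_eq_false, Finset.card_univ] at this
      rw [Fintype.card_subtype]
      omega
    obtain ⟨g⟩ := Function.Embedding.nonempty_of_card_le
      (α := Fin (k + 1)) (β := {i // (f i).isLeft}) (by simpa using hleft)
    choose h hh using fun a => Sum.isLeft_iff.1 (g a).2
    refine ⟨fun a => g a, h, Subtype.val_injective.comp g.injective, ?_, ?_⟩
    · intro a b hab
      exact g.injective (Subtype.ext (hf (by rw [hh, hh, hab])))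
    · intro a
      have := hft (g a)
      rw [hh] at this
      simpa [t] using this
  · right
    push Not at hall
    obtain ⟨W, hW⟩ := hall
    have hne : W.Nonempty := Finset.card_pos.1 (by omega)
    have hU : W.biUnion t =
        (Finset.univ.filter fun j => ∃ i ∈ W, R i j).disjSum Finset.univ := by
      ext (j | j)
      · simp [t]
      · simpa [t, Finset.Nonempty] using hne
    rw [hU, Finset.card_disjSum, Finset.card_univ, Fintype.card_fin] at hW
    refine ⟨Wᶜ, Finset.univ.filter fun j => ∃ i ∈ W, R i j, ?_, ?_⟩
    · have := Finset.card_le_univ W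
      rw [Finset.card_compl]
      omega
    · intro i j hij
      by_cases hi : i ∈ W
      · exact .inr (by simpa using ⟨i, hi, hij⟩)
      · exact .inl (by simpa using hi)

/-- Twice the signed area of the triangle with vertices `p`, `q`, `r`. -/
def orient (p q r : ℝ × ℝ) : ℝ :=
  (q.1 - p.1) * (r.2 - p.2) - (q.2 - p.2) * (r.1 - p.1)

/-- Each of the segments `pq` and `rs` strictly separates the endpoints of the other. -/
def StrictCross (p q r s : ℝ × ℝ) : Prop :=
  orient p q r * orient p q s < 0 ∧ orient r s p * orient r s q < 0

theorem orient_swap_left (p q r : ℝ × ℝ) : orient q p r = -orient p q r := by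
  simp only [orient]; ring

theorem orient_rotate (p q r : ℝ × ℝ) : orient q r p = orient p q r := by
  simp only [orient]; ring

theorem StrictCross.swap {p q r s : ℝ × ℝ} (h : StrictCross p q r s) : StrictCross r s p q :=
  ⟨h.2, h.1⟩

theorem StrictCross.swap_left {p q r s : ℝ × ℝ} (h : StrictCross p q r s) :
    StrictCross q p r s := by
  obtain ⟨h₁, h₂⟩ := h
  refine ⟨?_, by rwa [mul_comm]⟩
  rw [orient_swap_left p q r, orient_swap_left p q s]
  linarith

theorem StrictCross.swap_right {p q r s : ℝ × ℝ} (h : StrictCross p q r s) :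
    StrictCross p q s r :=
  h.swap.swap_left.swap

theorem StrictCross.ne {p q r s : ℝ × ℝ} (h : StrictCross p q r s) :
    p ≠ r ∧ p ≠ s ∧ q ≠ r ∧ q ≠ s := by
  obtain ⟨h₁, -⟩ := h
  refine ⟨?_, ?_, ?_, ?_⟩ <;> rintro rfl <;> simp [orient, mul_comm] at h₁

theorem orient_mul_neg_of_mem_openSegment {p q r s x : ℝ × ℝ} (hpq : x ∈ openSegment ℝ p q)
    (hrs : x ∈ openSegment ℝ r s) :
    orient p q r * orient p q s < 0 ∨ orient p q r = 0 ∧ orient p q s = 0 := by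
  obtain ⟨a, b, ha, hb, hab, rfl⟩ := hpq
  obtain ⟨c, d, hc, hd, hcd, h⟩ := hrs
  have h₁ : c * r.1 + d * s.1 = a * p.1 + b * q.1 := by simpa using congrArg Prod.fst h
  have h₂ : c * r.2 + d * s.2 = a * p.2 + b * q.2 := by simpa using congrArg Prod.snd h
  have key : c * orient p q r + d * orient p q s = 0 := by
    obtain rfl : a = 1 - b := by linarith
    obtain rfl : c = 1 - d := by linarith
    simp only [orient]
    linear_combination (q.1 - p.1) * h₂ - (q.2 - p.2) * h₁
  by_cases hs : orient p q s = 0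
  · right
    refine ⟨?_, hs⟩
    simpa [hs, hc.ne'] using key
  · left
    have : c * (orient p q r * orient p q s) = -(d * orient p q s ^ 2) := by
      linear_combination orient p q s * key
    have : 0 < d * orient p q s ^ 2 := by positivity
    by_contra hcon
    have := mul_nonneg hc.le (not_lt.1 hcon)
    linarith

theorem Crosses.strictCross {S : Set (ℝ × ℝ)}
    (hS : ∀ p ∈ S, ∀ q ∈ S, ∀ r ∈ S, p ≠ q → p ≠ r → q ≠ r → orient p q r ≠ 0)
    {p q r s : ℝ × ℝ} (hp : p ∈ S) (hq : q ∈ S) (hr : r ∈ S) (hs : s ∈ S) (hpq : p ≠ q)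
    (hrs : r ≠ s) (h : Crosses p q r s) : StrictCross p q r s := by
  obtain ⟨x, hx₁, hx₂, hx⟩ := h
  have hend : ∀ {p q r}, p ∈ S → q ∈ S → r ∈ S → p ≠ q → orient p q r = 0 → r = p ∨ r = q := by
    intro p q r hp hq hr hpq h
    by_contra! hne
    exact hS p hp q hq r hr hpq hne.1.symm hne.2.symm h
  have hsame : segment ℝ p q ≠ segment ℝ r s := by
    intro heq
    rw [← heq, Set.inter_self] at hx
    have h₁ : p ∈ ({x} : Set (ℝ × ℝ)) := hx ▸ left_mem_segment ℝ p q
    have h₂ : q ∈ ({x} : Set (ℝ × ℝ)) := hx ▸ right_mem_segment ℝ p q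
    exact hpq (h₁.trans h₂.symm)
  constructor
  · refine (orient_mul_neg_of_mem_openSegment hx₁ hx₂).resolve_right fun ⟨h₁, h₂⟩ => ?_
    rcases hend hp hq hr hpq h₁ with rfl | rfl <;> rcases hend hp hq hs hpq h₂ with rfl | rfl
    · exact hrs rfl
    · exact hsame rfl
    · exact hsame (segment_symm ..)
    · exact hrs rfl
  · refine (orient_mul_neg_of_mem_openSegment hx₂ hx₁).resolve_right fun ⟨h₁, h₂⟩ => ?_
    rcases hend hr hs hp hrs h₁ with rfl | rfl <;> rcases hend hr hs hq hrs h₂ with rfl | rfl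
    · exact hpq rfl
    · exact hsame rfl
    · exact hsame (segment_symm ..)
    · exact hpq rfl

theorem orient_eq_zero_of_collinear {p q r : ℝ × ℝ}
    (h : Collinear ℝ ({p, q, r} : Set (ℝ × ℝ))) : orient p q r = 0 := by
  obtain ⟨v, hv⟩ := (collinear_iff_of_mem (p₀ := p) (by simp)).1 h
  obtain ⟨a, rfl⟩ := hv q (by simp)
  obtain ⟨b, rfl⟩ := hv r (by simp)
  simp only [orient, vadd_eq_add, Prod.fst_add, Prod.snd_add, Prod.smul_fst, Prod.smul_snd,
    smul_eq_mul]
  ring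

/-- The point at parameter `a` of a small flat parabola at the point `i` of a point set. -/
def pt {ι : Type*} (X Y : ι → ℤ) (i : ι) (a : ℝ) : ℝ × ℝ := (X i + a, Y i + a ^ 2)

theorem abs_mul_sub_mul_le {u v α β C δ : ℝ} (hu : |u| ≤ C) (hv : |v| ≤ C) (hα : |α| ≤ δ)
    (hβ : |β| ≤ δ) : |(u + α) * (v + β) - u * v| ≤ 2 * C * δ + δ ^ 2 := by
  have hC : 0 ≤ C := (abs_nonneg _).trans hu
  have hδ : 0 ≤ δ := (abs_nonneg _).trans hα
  calc |(u + α) * (v + β) - u * v| = |u * β + α * v + α * β| := by congr 1; ring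
    _ ≤ |u| * |β| + |α| * |v| + |α| * |β| := by
      rw [← abs_mul, ← abs_mul, ← abs_mul]
      exact abs_add_three _ _ _
    _ ≤ C * δ + δ * C + δ * δ := by gcongr
    _ = 2 * C * δ + δ ^ 2 := by ring

section Cluster

variable {ι : Type*} {X Y : ι → ℤ} {C δ : ℝ}

theorem tri_mul_orient_pos (hX : ∀ i j, |(X i - X j : ℝ)| ≤ C) (hY : ∀ i j, |(Y i - Y j : ℝ)| ≤ C)
    (hδ : δ ≤ 1) (hCδ : 4 * C * δ + 3 * δ ^ 2 < 1) {i j k : ι} {a b c : ℝ}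
    (ha : a ∈ Set.Icc 0 δ) (hb : b ∈ Set.Icc 0 δ) (hc : c ∈ Set.Icc 0 δ) (h : tri X Y i j k ≠ 0) :
    0 < (tri X Y i j k : ℝ) * orient (pt X Y i a) (pt X Y j b) (pt X Y k c) := by
  have hsub : ∀ {a b : ℝ}, a ∈ Set.Icc 0 δ → b ∈ Set.Icc 0 δ → |b - a| ≤ δ := by
    rintro a b ⟨ha₀, ha₁⟩ ⟨hb₀, hb₁⟩
    exact abs_le.2 ⟨by linarith, by linarith⟩
  have hsq : ∀ {a : ℝ}, a ∈ Set.Icc 0 δ → a ^ 2 ∈ Set.Icc 0 δ := by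
    rintro a ⟨ha₀, ha₁⟩
    exact ⟨by positivity, by nlinarith⟩
  have h₁ := abs_le.1 (abs_mul_sub_mul_le (hX j i) (hY k i) (hsub ha hb) (hsub (hsq ha) (hsq hc)))
  have h₂ := abs_le.1 (abs_mul_sub_mul_le (hY j i) (hX k i) (hsub (hsq ha) (hsq hb)) (hsub ha hc))
  set o := orient (pt X Y i a) (pt X Y j b) (pt X Y k c) with ho
  have hdiff : o - tri X Y i j k =
      ((X j - X i + (b - a)) * (Y k - Y i + (c ^ 2 - a ^ 2)) - (X j - X i) * (Y k - Y i)) -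
      ((Y j - Y i + (b ^ 2 - a ^ 2)) * (X k - X i + (c - a)) - (Y j - Y i) * (X k - X i)) := by
    simp only [ho, orient, pt, tri]
    push_cast
    ring
  have hsq' := sq_nonneg δ
  rcases h.lt_or_gt with h | h
  · have : (tri X Y i j k : ℝ) ≤ -1 := by exact_mod_cast Int.le_sub_one_of_lt h
    exact mul_pos_of_neg_of_neg (by linarith) (by linarith)
  · have : (1 : ℝ) ≤ tri X Y i j k := by exact_mod_cast h
    exact mul_pos (by linarith) (by linarith)

theorem mul_orient_same_pos (hX : ∀ i j, |(X i - X j : ℝ)| ≤ C)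
    (hCδ : 4 * C * δ + 3 * δ ^ 2 < 1) {i k : ι} {a b c : ℝ}
    (ha : a ∈ Set.Icc 0 δ) (hb : b ∈ Set.Icc 0 δ) (hc : c ∈ Set.Icc 0 δ) (hab : a ≠ b)
    (hik : Y i ≠ Y k) :
    0 < (b - a) * (Y k - Y i) * orient (pt X Y i a) (pt X Y i b) (pt X Y k c) := by
  have ho : (b - a) * (Y k - Y i) * orient (pt X Y i a) (pt X Y i b) (pt X Y k c) =
      (b - a) ^ 2 *
        ((Y k - Y i) * ((Y k - Y i) + ((c ^ 2 - a ^ 2) - (a + b) * (X k - X i + (c - a))))) := by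
    simp only [orient, pt]
    ring
  have hC : 0 ≤ C := (abs_nonneg _).trans (hX k i)
  obtain ⟨ha₀, ha₁⟩ := ha
  obtain ⟨hb₀, hb₁⟩ := hb
  obtain ⟨hc₀, hc₁⟩ := hc
  have herr : |(c ^ 2 - a ^ 2) - (a + b) * (X k - X i + (c - a))| < 1 := by
    have h₁ : |c ^ 2 - a ^ 2| ≤ δ ^ 2 := abs_le.2 ⟨by nlinarith, by nlinarith⟩
    have h₂ : |X k - X i + (c - a)| ≤ C + δ :=
      (abs_add_le _ _).trans (add_le_add (hX k i) (abs_le.2 ⟨by linarith, by linarith⟩))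
    have h₃ : |(a + b) * (X k - X i + (c - a))| ≤ 2 * δ * (C + δ) := by
      rw [abs_mul, abs_of_nonneg (by linarith)]
      exact mul_le_mul (by linarith) h₂ (abs_nonneg _) (by linarith)
    have h₄ := abs_sub (c ^ 2 - a ^ 2) ((a + b) * (X k - X i + (c - a)))
    nlinarith [mul_nonneg hC (ha₀.trans ha₁)]
  rw [ho]
  refine mul_pos (by have := sub_ne_zero.2 hab.symm; positivity) ?_
  obtain ⟨h₁, h₂⟩ := abs_lt.1 herr
  rcases hik.lt_or_gt with h | h
  · have : (1 : ℝ) ≤ Y k - Y i := by exact_mod_cast Int.sub_pos.2 h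
    exact mul_pos (by linarith) (by linarith)
  · have : (1 : ℝ) ≤ Y i - Y k := by exact_mod_cast Int.sub_pos.2 h
    exact mul_pos_of_neg_of_neg (by linarith) (by linarith)

/-- The parabolas `pt X Y i` on `[0, δ]` are small and flat enough not to change the orientation of
triangles with vertices in three clusters, and to be separated from all other clusters like a
horizontal line. -/
structure IsFlat (X Y : ι → ℤ) (δ : ℝ) : Prop where
  tri_mul_orient_pos : ∀ {i j k : ι} {a b c : ℝ}, a ∈ Set.Icc 0 δ → b ∈ Set.Icc 0 δ →
    c ∈ Set.Icc 0 δ → tri X Y i j k ≠ 0 →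
    0 < (tri X Y i j k : ℝ) * orient (pt X Y i a) (pt X Y j b) (pt X Y k c)
  mul_orient_same_pos : ∀ {i k : ι} {a b c : ℝ}, a ∈ Set.Icc 0 δ → b ∈ Set.Icc 0 δ →
    c ∈ Set.Icc 0 δ → a ≠ b → Y i ≠ Y k →
    0 < (b - a) * (Y k - Y i) * orient (pt X Y i a) (pt X Y i b) (pt X Y k c)

theorem exists_isFlat [Finite ι] (X Y : ι → ℤ) : ∃ δ > 0, δ < 1 ∧ IsFlat X Y δ := by
  obtain ⟨A, hA⟩ := (Set.finite_range fun p : ι × ι => |(X p.1 - X p.2 : ℝ)|).bddAbove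
  obtain ⟨B, hB⟩ := (Set.finite_range fun p : ι × ι => |(Y p.1 - Y p.2 : ℝ)|).bddAbove
  set C := max 1 (max A B) with hC
  have hX : ∀ i j, |(X i - X j : ℝ)| ≤ C := fun i j =>
    (hA ⟨(i, j), rfl⟩).trans ((le_max_left A B).trans (le_max_right 1 _))
  have hY : ∀ i j, |(Y i - Y j : ℝ)| ≤ C := fun i j =>
    (hB ⟨(i, j), rfl⟩).trans ((le_max_right A B).trans (le_max_right 1 _))
  have hC₁ : 1 ≤ C := le_max_left ..
  have hδ : 1 / (8 * C) ≤ 1 / 8 := by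
    apply one_div_le_one_div_of_le <;> linarith
  have hδ₀ : 0 < 1 / (8 * C) := by positivity
  have hCδ : 4 * C * (1 / (8 * C)) + 3 * (1 / (8 * C)) ^ 2 < 1 := by
    have : 4 * C * (1 / (8 * C)) = 1 / 2 := by field_simp; norm_num
    nlinarith
  exact ⟨1 / (8 * C), hδ₀, by linarith, fun ha hb hc h => tri_mul_orient_pos hX hY (by linarith) hCδ ha hb hc h,
    fun ha hb hc h h' => mul_orient_same_pos hX hCδ ha hb hc h h'⟩

theorem IsFlat.orient_ne_zero (hF : IsFlat X Y δ) (hY : Function.Injective Y)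
    (htri : ∀ i j k, i ≠ j → i ≠ k → j ≠ k → tri X Y i j k ≠ 0) {i j k : ι} {a b c : ℝ}
    (ha : a ∈ Set.Icc 0 δ) (hb : b ∈ Set.Icc 0 δ) (hc : c ∈ Set.Icc 0 δ)
    (hij : pt X Y i a ≠ pt X Y j b) (hik : pt X Y i a ≠ pt X Y k c)
    (hjk : pt X Y j b ≠ pt X Y k c) : orient (pt X Y i a) (pt X Y j b) (pt X Y k c) ≠ 0 := by
  have same : ∀ {i k : ι} {a b c : ℝ}, a ∈ Set.Icc 0 δ → b ∈ Set.Icc 0 δ → c ∈ Set.Icc 0 δ →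
      a ≠ b → i ≠ k → orient (pt X Y i a) (pt X Y i b) (pt X Y k c) ≠ 0 :=
    fun ha hb hc hab hik => right_ne_zero_of_mul
      (hF.mul_orient_same_pos ha hb hc hab (hY.ne hik)).ne'
  by_cases h₁ : i = j
  · subst h₁
    have hab : a ≠ b := by rintro rfl; exact hij rfl
    by_cases h₂ : i = k
    · subst h₂
      have hac : c - a ≠ 0 := sub_ne_zero.2 (by rintro rfl; exact hik rfl)
      have hbc : c - b ≠ 0 := sub_ne_zero.2 (by rintro rfl; exact hjk rfl)
      have : orient (pt X Y i a) (pt X Y i b) (pt X Y i c) = (b - a) * (c - a) * (c - b) := by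
        simp only [orient, pt]; ring
      rw [this]
      exact mul_ne_zero (mul_ne_zero (sub_ne_zero.2 hab.symm) hac) hbc
    · exact same ha hb hc hab h₂
  by_cases h₂ : i = k
  · subst h₂
    rw [orient_rotate]
    exact same hc ha hb (by rintro rfl; exact hik rfl) h₁
  by_cases h₃ : j = k
  · subst h₃
    rw [← orient_rotate]
    exact same hb hc ha (by rintro rfl; exact hjk rfl) (Ne.symm h₁)
  · exact right_ne_zero_of_mul (hF.tri_mul_orient_pos ha hb hc (htri i j k h₁ h₂ h₃)).ne'

theorem IsFlat.intCross (hF : IsFlat X Y δ)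
    (htri : ∀ i j k, i ≠ j → i ≠ k → j ≠ k → tri X Y i j k ≠ 0) {i j k l : ι} {a b c d : ℝ}
    (ha : a ∈ Set.Icc 0 δ) (hb : b ∈ Set.Icc 0 δ) (hc : c ∈ Set.Icc 0 δ) (hd : d ∈ Set.Icc 0 δ)
    (hij : i ≠ j) (hik : i ≠ k) (hil : i ≠ l) (hjk : j ≠ k) (hjl : j ≠ l) (hkl : k ≠ l)
    (h : StrictCross (pt X Y i a) (pt X Y j b) (pt X Y k c) (pt X Y l d)) :
    IntCross X Y i j k l := by
  have aux : ∀ {u v : ℤ} {x y : ℝ}, 0 < u * x → 0 < v * y → x * y < 0 → u * v < 0 := by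
    intro u v x y hx hy hxy
    have : (u * v : ℝ) < 0 := by
      refine neg_of_mul_pos_left ?_ hxy.le
      linarith [mul_pos hx hy, mul_mul_mul_comm (u : ℝ) x v y]
    exact_mod_cast this
  exact ⟨aux (hF.tri_mul_orient_pos ha hb hc (htri i j k hij hik hjk))
      (hF.tri_mul_orient_pos ha hb hd (htri i j l hij hil hjl)) h.1,
    aux (hF.tri_mul_orient_pos hc hd ha (htri k l i hkl hik.symm hil.symm))
      (hF.tri_mul_orient_pos hc hd hb (htri k l j hkl hjk.symm hjl.symm)) h.2⟩

theorem IsFlat.eq_or_eq_of_strictCross (hF : IsFlat X Y δ) (hY : Function.Injective Y)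
    (htri : ∀ i j k, i ≠ j → i ≠ k → j ≠ k → tri X Y i j k ≠ 0) {i k l : ι} {a b c d : ℝ}
    (ha : a ∈ Set.Icc 0 δ) (hb : b ∈ Set.Icc 0 δ) (hc : c ∈ Set.Icc 0 δ) (hd : d ∈ Set.Icc 0 δ)
    (h : StrictCross (pt X Y i a) (pt X Y i b) (pt X Y k c) (pt X Y l d)) : k = i ∨ l = i := by
  have aux : ∀ {u x y : ℝ}, 0 < u * x → 0 < u * y → 0 < x * y := by
    intro u x y hx hy
    refine pos_of_mul_pos_right (a := u * u) ?_ (mul_self_nonneg u)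
    linarith [mul_pos hx hy, mul_mul_mul_comm u x u y]
  by_contra! hne
  obtain ⟨hki, hli⟩ := hne
  refine h.2.not_gt ?_
  by_cases hkl : k = l
  · subst hkl
    have hcd : c ≠ d := by
      rintro rfl
      simpa [orient] using h.2
    exact aux (hF.mul_orient_same_pos hc hd ha hcd (hY.ne hki))
      (hF.mul_orient_same_pos hc hd hb hcd (hY.ne hki))
  · exact aux (hF.tri_mul_orient_pos hc hd ha (htri k l i hkl hki hli))
      (hF.tri_mul_orient_pos hc hd hb (htri k l i hkl hki hli))

theorem IsFlat.not_strictCross (hF : IsFlat X Y δ) {i j k : ι} {a b c d : ℝ}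
    (ha : a ∈ Set.Icc 0 δ) (hb : b ∈ Set.Icc 0 δ) (hc : c ∈ Set.Icc 0 δ) (hd : d ∈ Set.Icc 0 δ)
    (hij : Y i < Y j) (hki : Y k < Y i) :
    ¬StrictCross (pt X Y i a) (pt X Y j b) (pt X Y i c) (pt X Y k d) := by
  intro h
  have hac : a ≠ c := by rintro rfl; exact h.ne.1 rfl
  have h₁ := hF.mul_orient_same_pos ha hc hb hac hij.ne
  have h₂ := hF.mul_orient_same_pos ha hc hd hac hki.ne'
  obtain ⟨h₃, h₄⟩ := h
  have hij' : (0 : ℝ) < Y j - Y i := by exact_mod_cast Int.sub_pos.2 hij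
  have hki' : (Y k - Y i : ℝ) < 0 := by exact_mod_cast Int.sub_neg_of_lt hki
  set p := pt X Y i a
  set q := pt X Y j b
  set r := pt X Y i c
  set s := pt X Y k d
  have e₁ : orient p q r = -orient p r q := by simp only [orient]; ring
  have e₂ : orient r s p = orient p r s := by simp only [orient]; ring
  have e : orient r s q + orient p q s = orient p r s - orient p r q := by
    simp only [orient]; ring
  rw [e₁] at h₃
  rw [e₂] at h₄
  rcases hac.lt_or_gt with hlt | hlt
  · have hpos : 0 < orient p r q :=
      pos_of_mul_pos_right h₁ (mul_pos (by linarith) hij').le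
    have hneg : orient p r s < 0 :=
      neg_of_mul_pos_right h₂ (mul_neg_of_pos_of_neg (by linarith) hki').le
    have := pos_of_mul_neg_right h₃ (by linarith)
    have := pos_of_mul_neg_right h₄ hneg.le
    linarith
  · have hneg : orient p r q < 0 :=
      neg_of_mul_pos_right h₁ (mul_neg_of_neg_of_pos (by linarith) hij').le
    have hpos : 0 < orient p r s :=
      pos_of_mul_pos_right h₂ (mul_pos_of_neg_of_neg (by linarith) hki').le
    have := neg_of_mul_neg_right h₃ (by linarith)
    have := neg_of_mul_neg_right h₄ hpos.le
    linarith

end Cluster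

section Counting

variable {ι : Type*} {t : ℕ} {G : Finset ((ι × Fin t) × (ι × Fin t))}

theorem card_le_of_cover
    (hdisj : ∀ e ∈ G, ∀ f ∈ G, e ≠ f → e.1 ≠ f.1 ∧ e.1 ≠ f.2 ∧ e.2 ≠ f.1 ∧ e.2 ≠ f.2)
    (W : Finset ι) (hW : ∀ e ∈ G, e.1.1 ∈ W ∨ e.2.1 ∈ W) : G.card ≤ W.card * t := by
  classical
  have : (W ×ˢ (Finset.univ : Finset (Fin t))).card = W.card * t := by simp
  rw [← this]
  refine Finset.card_le_card_of_injOn (fun e => if e.1.1 ∈ W then e.1 else e.2) ?_ ?_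
  · intro e he
    have := hW e he
    by_cases h : e.1.1 ∈ W <;> simp_all
  · intro e he f hf hef
    by_contra hne
    obtain ⟨h₁, h₂, h₃, h₄⟩ := hdisj e he f hf hne
    dsimp only at hef
    split_ifs at hef <;> contradiction

theorem card_le_mul_of_forall_matching [LinearOrder ι] [Fintype ι] {k : ℕ} (hk : 1 ≤ k)
    (hdisj : ∀ e ∈ G, ∀ f ∈ G, e ≠ f → e.1 ≠ f.1 ∧ e.1 ≠ f.2 ∧ e.2 ≠ f.1 ∧ e.2 ≠ f.2)
    (hloop : ∀ e ∈ G, e.1.1 = e.2.1 → ∀ f ∈ G, f.1.1 = e.1.1 ∨ f.2.1 = e.1.1)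
    (hmatch : ∀ l h : Fin (k + 1) → ι, Function.Injective l → Function.Injective h →
      (∀ a, l a < h a ∧ ∃ e ∈ G, s(e.1.1, e.2.1) = s(l a, h a)) → False) :
    G.card ≤ k * t := by
  by_cases h : ∃ e ∈ G, e.1.1 = e.2.1
  · obtain ⟨e, he, hee⟩ := h
    calc G.card ≤ ({e.1.1} : Finset ι).card * t :=
          card_le_of_cover hdisj _ (by simpa using hloop e he hee)
      _ ≤ k * t := by rw [Finset.card_singleton]; gcongr
  push Not at h
  rcases exists_matching_or_cover
    (fun i j : ι => i < j ∧ ∃ e ∈ G, s(e.1.1, e.2.1) = s(i, j)) k with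
    ⟨l, h, hl, hh, hR⟩ | ⟨A, B, hAB, hcov⟩
  · exact (hmatch l h hl hh hR).elim
  · calc G.card ≤ (A ∪ B).card * t := by
          refine card_le_of_cover hdisj _ fun e he => ?_
          simp only [Finset.mem_union]
          rcases (h e he).lt_or_gt with hlt | hlt
          · have := hcov _ _ ⟨hlt, e, he, rfl⟩
            tauto
          · have := hcov _ _ ⟨hlt, e, he, Sym2.eq_swap⟩
            tauto
      _ ≤ k * t := by
          gcongr
          exact (Finset.card_union_le A B).trans hAB

end Counting

theorem exists_card_eq_mul_and_crossingFamily_card_le {ι : Type*} [LinearOrder ι] [Fintype ι]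
    {k : ℕ} (hk : 1 ≤ k) (X Y : ι → ℤ) (hY : StrictMono Y)
    (htri : ∀ i j k, i ≠ j → i ≠ k → j ≠ k → tri X Y i j k ≠ 0)
    (hcross : ∀ l h : Fin (k + 1) → ι, (∀ a, l a < h a) →
      (∀ a b, a ≠ b → IntCross X Y (l a) (h a) (l b) (h b)) → False) (t : ℕ) :
    ∃ S : Finset (ℝ × ℝ), S.card = Fintype.card ι * t ∧ GenPos S ∧
      ∀ F, IsCrossingFamily S F → F.card ≤ k * t := by
  obtain ⟨δ, hδ, hδ₁, hF⟩ := exists_isFlat X Y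
  let par : Fin t → ℝ := fun n => δ / (n + 1)
  have hpar : ∀ n, par n ∈ Set.Icc 0 δ := fun n =>
    ⟨by positivity, div_le_self hδ.le (by linarith [(Nat.cast_nonneg (n : ℕ) : (0 : ℝ) ≤ _)])⟩
  let φ : ι × Fin t → ℝ × ℝ := fun v => pt X Y v.1 (par v.2)
  have hpar_inj : Function.Injective par := by
    intro n n' h
    have h₁ : (0 : ℝ) < n + 1 := by positivity
    have h₂ : (0 : ℝ) < n' + 1 := by positivity
    rw [div_eq_div_iff h₁.ne' h₂.ne', mul_right_inj' hδ.ne'] at h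
    exact Fin.ext (by exact_mod_cast (add_right_cancel h).symm)
  have hsame : ∀ {i : ι} {n n' : Fin t}, φ (i, n) = φ (i, n') → n = n' := fun {i n n'} h =>
    hpar_inj (add_left_cancel (congrArg Prod.fst h))
  have hφ : Function.Injective φ := by
    rintro ⟨i, n⟩ ⟨j, n'⟩ h
    obtain rfl : i = j := by
      apply hY.injective
      have h₁ : (Y i + par n ^ 2 : ℝ) = Y j + par n' ^ 2 := congrArg Prod.snd h
      obtain ⟨ha₀, ha₁⟩ := hpar n
      obtain ⟨hb₀, hb₁⟩ := hpar n'
      have h₂ : (Y i - Y j : ℝ) < 1 := by nlinarith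
      have h₃ : (-1 : ℝ) < Y i - Y j := by nlinarith
      have h₄ : Y i - Y j < 1 := by exact_mod_cast h₂
      have h₅ : -1 < Y i - Y j := by exact_mod_cast h₃
      omega
    rw [hsame h]
  have hor : ∀ u v w, φ u ≠ φ v → φ u ≠ φ w → φ v ≠ φ w → orient (φ u) (φ v) (φ w) ≠ 0 :=
    fun u v w => hF.orient_ne_zero hY.injective htri (hpar _) (hpar _) (hpar _)
  have hS : ∀ p ∈ Set.range φ, ∀ q ∈ Set.range φ, ∀ r ∈ Set.range φ,
      p ≠ q → p ≠ r → q ≠ r → orient p q r ≠ 0 := by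
    rintro _ ⟨u, rfl⟩ _ ⟨v, rfl⟩ _ ⟨w, rfl⟩
    exact hor u v w
  refine ⟨Finset.univ.map ⟨φ, hφ⟩, by simp, ?_, ?_⟩
  · intro p hp q hq r hr hpq hpr hqr hcol
    refine hS p ?_ q ?_ r ?_ hpq hpr hqr (orient_eq_zero_of_collinear hcol) <;> simp_all
  rintro F ⟨hmem, hF'⟩
  classical
  set G : Finset ((ι × Fin t) × (ι × Fin t)) :=
    Finset.univ.filter fun e => (φ e.1, φ e.2) ∈ F with hG
  have hFG : F.card ≤ G.card := by
    have : F ⊆ G.image (Prod.map φ φ) := by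
      rintro ⟨p, q⟩ hpq
      obtain ⟨hp, hq, -⟩ := hmem _ hpq
      simp only [Finset.mem_map, Finset.mem_univ, true_and, Function.Embedding.coeFn_mk] at hp hq
      obtain ⟨u, rfl⟩ := hp
      obtain ⟨v, rfl⟩ := hq
      exact Finset.mem_image.2 ⟨(u, v), by simpa [hG] using hpq, rfl⟩
    exact (Finset.card_le_card this).trans Finset.card_image_le
  refine hFG.trans ?_
  have hGF : ∀ {e}, e ∈ G → (φ e.1, φ e.2) ∈ F := fun he => (Finset.mem_filter.1 he).2
  have hG_cross : ∀ e ∈ G, ∀ f ∈ G, e ≠ f →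
      StrictCross (φ e.1) (φ e.2) (φ f.1) (φ f.2) := by
    intro e he f hf hef
    refine (hF' _ (hGF he) _ (hGF hf) ?_).strictCross hS ⟨_, rfl⟩ ⟨_, rfl⟩ ⟨_, rfl⟩ ⟨_, rfl⟩
      (hmem _ (hGF he)).2.2 (hmem _ (hGF hf)).2.2
    intro h
    exact hef (Prod.ext (hφ (congrArg Prod.fst h)) (hφ (congrArg Prod.snd h)))
  refine card_le_mul_of_forall_matching hk ?_ ?_ ?_
  · intro e he f hf hef
    have h := (hG_cross e he f hf hef).ne
    exact ⟨fun h' => h.1 (h' ▸ rfl), fun h' => h.2.1 (h' ▸ rfl), fun h' => h.2.2.1 (h' ▸ rfl),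
      fun h' => h.2.2.2 (h' ▸ rfl)⟩
  · rintro ⟨⟨i, n₁⟩, ⟨j, n₂⟩⟩ he hij f hf
    dsimp only at hij
    subst hij
    by_cases hef : ((i, n₁), (i, n₂)) = f
    · exact .inl (hef ▸ rfl)
    · exact hF.eq_or_eq_of_strictCross hY.injective htri (hpar _) (hpar _) (hpar _) (hpar _)
        (hG_cross _ he f hf hef)
  · intro l h hl hh hlh
    have hends : ∀ a, ∃ e ∈ G, ∃ u v : Fin t,
        e = ((l a, u), (h a, v)) ∨ e = ((h a, v), (l a, u)) := by
      intro a
      obtain ⟨-, ⟨⟨i, u⟩, ⟨j, v⟩⟩, he, heq⟩ := hlh a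
      rcases Sym2.eq_iff.1 heq with ⟨rfl, rfl⟩ | ⟨rfl, rfl⟩
      · exact ⟨_, he, u, v, .inl rfl⟩
      · exact ⟨_, he, v, u, .inr rfl⟩
    choose e he u v huv using hends
    have hlt : ∀ a, l a < h a := fun a => (hlh a).1
    have hsc : ∀ a b, a ≠ b →
        StrictCross (φ (l a, u a)) (φ (h a, v a)) (φ (l b, u b)) (φ (h b, v b)) := by
      intro a b hab
      have hne : e a ≠ e b := by
        intro heq
        have h₁ := hl.ne hab
        have h₂ := hlt a
        have h₃ := hlt b
        rcases huv a with ha | ha <;> rcases huv b with hb | hb <;> rw [ha, hb] at heq <;>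
          simp only [Prod.mk.injEq] at heq <;> obtain ⟨⟨h₄, -⟩, ⟨h₅, -⟩⟩ := heq
        · exact h₁ h₄
        · rw [h₄, h₅] at h₂
          exact h₂.asymm h₃
        · rw [h₄, h₅] at h₂
          exact h₂.asymm h₃
        · exact h₁ h₅
      have hcr := hG_cross _ (he a) _ (he b) hne
      rcases huv a with ha | ha <;> rcases huv b with hb | hb <;> rw [ha, hb] at hcr
      · exact hcr
      · exact hcr.swap_right
      · exact hcr.swap_left
      · exact hcr.swap_left.swap_right
    have hlh_ne : ∀ a b, l a ≠ h b := by
      intro a b heq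
      by_cases hab : a = b
      · subst hab
        exact (hlt a).ne heq
      · have hcr := (hsc a b hab).swap_right
        have hba := hlt b
        rw [← heq] at hba hcr
        exact hF.not_strictCross (hpar _) (hpar _) (hpar _) (hpar _) (hY (hlt a)) (hY hba) hcr
    exact hcross l h hlt fun a b hab => hF.intCross htri (hpar _) (hpar _) (hpar _) (hpar _)
      (hlt a).ne (hl.ne hab) (hlh_ne a b) (hlh_ne b a).symm (hh.ne hab) (hlt b).ne (hsc a b hab)

theorem exists_card_eq_and_cf_le (n : ℕ) :
    ∃ S : Finset (ℝ × ℝ), S.card = n ∧ GenPos S ∧ cf S ≤ 4 * (n ⌈/⌉ 20) := by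
  obtain ⟨T, hT, hgen, hF⟩ := exists_card_eq_mul_and_crossingFamily_card_le (k := 4) (by norm_num)
    (fun i : Fin 20 => xs.getD i 0) (fun i : Fin 20 => ys.getD i 0) strictMono_ys tri_xs_ys_ne_zero
    not_forall_intCross (n ⌈/⌉ 20)
  have hn : n ≤ T.card := by
    rw [hT, Fintype.card_fin, Nat.ceilDiv_eq_add_pred_div]
    omega
  obtain ⟨S, hST, hS⟩ := Finset.exists_subset_card_eq hn
  refine ⟨S, hS, fun p hp q hq r hr => hgen p (hST hp) q (hST hq) r (hST hr), csSup_le' ?_⟩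
  rintro _ ⟨F, ⟨hF₁, hF₂⟩, rfl⟩
  exact hF F ⟨fun e he => ⟨hST (hF₁ e he).1, hST (hF₁ e he).2.1, (hF₁ e he).2.2⟩, hF₂⟩

/-- For every positive integer `n`, `cf(n) ≤ 4 * ⌈n / 20⌉`: there exists a set
of `n` points in the plane in general position whose largest crossing family
has size at most `4 * ⌈n / 20⌉`. -/
theorem cfNat_le_4_mul_ceilDiv_20 (n : ℕ) (hn : 0 < n) :
    cfNat n ≤ 4 * (n ⌈/⌉ 20) ∧
    ∃ S : Finset (ℝ × ℝ), S.card = n ∧ GenPos S ∧ cf S ≤ 4 * (n ⌈/⌉ 20) := by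
  obtain ⟨S, hS, hgen, hcf⟩ := exists_card_eq_and_cf_le n
  exact ⟨le_trans (Nat.sInf_le ⟨S, hS, hgen, rfl⟩) hcf, S, hS, hgen, hcf⟩
end

section
/- There exists a set of 29 points in the plane in general position that contains no 7-crossing family. -/
namespace CrossingFamily

/-! ### Computable counterparts -/

/-- `left a b c` holds if `c` lies strictly to the left of the directed line `ab`. -/
def left (a b c : ℕ × ℕ) : Bool :=
  Nat.blt (a.2 * b.1 + (b.2 * c.1 + c.2 * a.1)) (a.1 * b.2 + (b.1 * c.2 + c.1 * a.2))

/-- The endpoints of `f` lie strictly on different sides of the line through `e`. -/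
def splits (e f : (ℕ × ℕ) × (ℕ × ℕ)) : Bool :=
  (left e.1 e.2 f.1 && left e.2 e.1 f.2) || (left e.2 e.1 f.1 && left e.1 e.2 f.2)

/-- All pairs of entries of a list, in lexicographic order of positions. -/
def pairs {α : Type} : List α → List (α × α)
  | [] => []
  | a :: l => l.map (fun b => (a, b)) ++ pairs l

/-- Concatenation of a list of blocks of `N` bits. -/
def pack (N : ℕ) : List ℕ → ℕ
  | [] => 0
  | x :: l => x ||| (pack N l <<< N)

/-- The set of positions in `l` at which `p` holds, as a bit mask. -/
def mask {α : Type} (p : α → Bool) (l : List α) : ℕ :=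
  pack 1 (l.map fun a => (p a).toNat)

/-- The set of entries of `l`, as a bit mask. -/
def bits (l : List ℕ) : ℕ := l.foldr (fun v m => 2 ^ v ||| m) 0

/-- `force n f` equals `f n`, but the kernel evaluates `n` to a numeral first. -/
def force {α : Type} (n : ℕ) (f : ℕ → α) : α :=
  match n with
  | 0 => f 0
  | Nat.succ k => f (Nat.succ k)

/-- Continuation-passing `List.map`. -/
def mapThen {α β γ : Type} (g : β → (γ → α) → α) : List β → (List γ → α) → α
  | [], f => f []
  | b :: l, f => g b fun c => mapThen g l fun r => f (c :: r)

/-- A point together with three bit masks over a list of segments: the segments with this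
endpoint, those having the point on their left, and those having it on their right. -/
structure Vertex where
  pt : ℕ × ℕ
  star : ℕ
  onLeft : ℕ
  onRight : ℕ

def hasEndpoint (p : ℕ × ℕ) (e : (ℕ × ℕ) × (ℕ × ℕ)) : Bool :=
  (Nat.beq p.1 e.1.1 && Nat.beq p.2 e.1.2) || (Nat.beq p.1 e.2.1 && Nat.beq p.2 e.2.2)

def vertex (E : List ((ℕ × ℕ) × (ℕ × ℕ))) (p : ℕ × ℕ) : Vertex :=
  ⟨p, mask (hasEndpoint p) E, mask (fun e => left e.1 e.2 p) E, mask (fun e => left e.2 e.1 p) E⟩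

def withVertex {α : Type} (E : List ((ℕ × ℕ) × (ℕ × ℕ))) (p : ℕ × ℕ) (f : Vertex → α) : α :=
  force (mask (hasEndpoint p) E) fun s => force (mask (fun e => left e.1 e.2 p) E) fun l =>
    force (mask (fun e => left e.2 e.1 p) E) fun r => f ⟨p, s, l, r⟩

/-- The segments with an endpoint to the left of the directed line `ab`, as a bit mask. -/
def starsLeft (a b : ℕ × ℕ) : List Vertex → ℕ
  | [] => 0
  | c :: Q => cond (left a b c.pt) (c.star ||| starsLeft a b Q) (starsLeft a b Q)

/-- The segments crossing the segment `e`, as a bit mask. -/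
def row (Q : List Vertex) (e : Vertex × Vertex) : ℕ :=
  ((e.1.onLeft &&& e.2.onRight) ||| (e.1.onRight &&& e.2.onLeft)) &&&
    (starsLeft e.1.pt e.2.pt Q &&& starsLeft e.2.pt e.1.pt Q)

/-- The number of sets among `Ks` that meet `C`. -/
def countMeeting (C : ℕ) : List (ℕ × List ℕ) → ℕ
  | [] => 0
  | K :: Ks => cond (Nat.beq (K.1 &&& C) 0) 0 1 + countMeeting C Ks

/-- Enlarges the set `X` by elements below 64. The kernel hashes a numeral by its lowest 64 bits;
filling them keeps its caches efficient. -/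
def scramble (X : ℕ) : ℕ := X ||| X % (2 ^ 64 - 59)

/-- Branch-and-bound certificate that the graph with packed adjacency matrix `B`, restricted to
`C` and to the union of the independent sets `Ks`, has no clique with more than `k` vertices.
Each independent set comes as a bit mask and as a list. -/
def search (N B : ℕ) : List (ℕ × List ℕ) → ℕ → ℕ → Bool
  | [], _, _ => true
  | K :: Ks, C, k => Nat.ble (countMeeting C (K :: Ks)) k ||
    match k with
    | 0 => false
    | k' + 1 =>
      (K.2.all fun v => Nat.beq (C &&& Nat.pow 2 v) 0 ||
        force (C &&& B >>> (N * v)) fun X => force (scramble X) fun C' => search N B Ks C' k') &&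
      search N B Ks C (k' + 1)

/-- No two elements of `K` are adjacent. -/
def independent (N B : ℕ) (K : ℕ × List ℕ) : Bool :=
  K.2.all fun v => Nat.beq (B >>> (N * v) &&& K.1) 0

/-- Certificate that the graph with packed adjacency matrix `B` on the vertices `64, …, N - 1`,
partitioned into independent sets `cs`, has no clique with more than `k` vertices. -/
def certifyGraph (N B k : ℕ) (cs : List (List ℕ)) : Bool :=
  mapThen (fun l f => force (bits l) fun m => f (m, l)) cs fun Ks =>
    Nat.beq (Ks.foldr (fun K m => K.1 ||| m) (2 ^ 64 - 1)) (2 ^ N - 1) &&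
      Ks.all (independent N B) && search N B Ks (2 ^ N - 1) k

/-- Certificate that the points `l` span no crossing family with more than `k` segments. The
segment at position `i` of `pairs l` is vertex `64 + i` of the crossing graph. -/
def certify (k : ℕ) (l : List (ℕ × ℕ)) (cs : List (List ℕ)) : Bool :=
  force (64 + (pairs l).length) fun N =>
    mapThen (withVertex (pairs l)) l fun Q =>
      force (pack N ((pairs Q).map (row Q)) <<< (N * 64 + 64)) fun B => certifyGraph N B k cs

/-- No segment of `l` is collinear with a third point of `l`. -/
def generalPosition (l : List (ℕ × ℕ)) : Bool :=
  (pairs l).all fun e => l.all fun c => hasEndpoint c e || left e.1 e.2 c || left e.2 e.1 c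

/-! ### Soundness of the search -/

theorem force_eq {α : Type} (n : ℕ) (f : ℕ → α) : force n f = f n := by
  cases n <;> rfl

theorem mapThen_eq {α β γ : Type} {g : β → (γ → α) → α} {h : β → γ}
    (hg : ∀ b f, g b f = f (h b)) (l : List β) (f : List γ → α) :
    mapThen g l f = f (l.map h) := by
  induction l generalizing f with
  | nil => rfl
  | cons b l ih => simp [mapThen, hg, ih]

theorem testBit_bits (l : List ℕ) (i : ℕ) : (bits l).testBit i = true ↔ i ∈ l := by
  induction l with
  | nil => simp [bits]
  | cons v l ih =>
    have : bits (v :: l) = 2 ^ v ||| bits l := rfl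
    rw [this, Nat.testBit_or, Nat.testBit_two_pow, Bool.or_eq_true, decide_eq_true_iff, ih,
      List.mem_cons, eq_comm]

theorem testBit_pack {N : ℕ} {l : List ℕ} {i j x : ℕ} (hx : l[i]? = some x)
    (hj : x.testBit j = true) : (pack N l).testBit (N * i + j) = true := by
  induction l generalizing i with
  | nil => simp at hx
  | cons y l ih =>
    cases i with
    | zero =>
      obtain rfl : y = x := by simpa using hx
      simp [pack, Nat.testBit_or, hj]
    | succ i =>
      have h := ih (i := i) (by simpa using hx)
      have e : N * (i + 1) + j - N = N * i + j := by
        rw [Nat.mul_succ]; omega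
      have le : N ≤ N * (i + 1) + j := by
        rw [Nat.mul_succ]; omega
      simp [pack, Nat.testBit_or, Nat.testBit_shiftLeft, e, le, h]

theorem testBit_mask {α : Type} {p : α → Bool} {l : List α} {i : ℕ} {a : α}
    (ha : l[i]? = some a) (hp : p a = true) : (mask p l).testBit i = true := by
  have := testBit_pack (N := 1) (l := l.map fun a => (p a).toNat) (i := i) (j := 0) (x := 1)
    (by simp [ha, hp]) (by simp)
  simpa [mask] using this

/-- Each entry of `Ks` consists of a bit mask and a list describing the same set. -/
def Masked (Ks : List (ℕ × List ℕ)) : Prop :=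
  ∀ K ∈ Ks, ∀ i, K.1.testBit i = true ↔ i ∈ K.2

def Clique (N B : ℕ) (T : Finset ℕ) : Prop :=
  ∀ i ∈ T, ∀ j ∈ T, i ≠ j → B.testBit (N * i + j) = true

def Independent (N B : ℕ) (K : ℕ × List ℕ) : Prop :=
  ∀ i ∈ K.2, ∀ j ∈ K.2, ¬ B.testBit (N * i + j) = true

theorem Clique.erase {N B : ℕ} {T : Finset ℕ} (hT : Clique N B T) (i : ℕ) :
    Clique N B (T.erase i) :=
  fun _ ha _ hb => hT _ (Finset.mem_of_mem_erase ha) _ (Finset.mem_of_mem_erase hb)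

/-- A clique covered by `K :: Ks` is covered by `Ks` once its vertex in `K` is removed. -/
theorem Clique.cover_erase {N B : ℕ} {K : ℕ × List ℕ} {Ks : List (ℕ × List ℕ)} {T : Finset ℕ}
    (hT : Clique N B T) (hK : Independent N B K) (hcov : ∀ i ∈ T, ∃ L ∈ K :: Ks, i ∈ L.2)
    {v : ℕ} (hv : v ∈ T) (hvK : v ∈ K.2) : ∀ i ∈ T.erase v, ∃ L ∈ Ks, i ∈ L.2 := by
  intro i hi
  obtain ⟨hne, hi⟩ := Finset.mem_erase.1 hi
  obtain ⟨L, hL, hiL⟩ := hcov i hi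
  rcases List.mem_cons.1 hL with rfl | hL
  · exact absurd (hT v hv i hi hne.symm) (hK v hvK i hiL)
  · exact ⟨L, hL, hiL⟩

theorem cover_tail {K : ℕ × List ℕ} {Ks : List (ℕ × List ℕ)} {T : Finset ℕ}
    (hcov : ∀ i ∈ T, ∃ L ∈ K :: Ks, i ∈ L.2) (h : ¬ ∃ v ∈ T, v ∈ K.2) :
    ∀ i ∈ T, ∃ L ∈ Ks, i ∈ L.2 := by
  intro i hi
  obtain ⟨L, hL, hiL⟩ := hcov i hi
  rcases List.mem_cons.1 hL with rfl | hL
  · exact absurd ⟨i, hi, hiL⟩ h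
  · exact ⟨L, hL, hiL⟩

theorem land_ne_zero {x y i : ℕ} (hx : x.testBit i = true) (hy : y.testBit i = true) :
    x &&& y ≠ 0 := by
  intro h
  have : (x &&& y).testBit i = true := by simp [hx, hy]
  simp [h] at this

theorem card_le_countMeeting {N B C : ℕ} {Ks : List (ℕ × List ℕ)} (hM : Masked Ks)
    (hI : ∀ K ∈ Ks, Independent N B K) {T : Finset ℕ} (hT : Clique N B T)
    (hC : ∀ i ∈ T, C.testBit i = true) (hcov : ∀ i ∈ T, ∃ K ∈ Ks, i ∈ K.2) :
    T.card ≤ countMeeting C Ks := by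
  induction Ks generalizing T with
  | nil =>
    have : T = ∅ := Finset.eq_empty_of_forall_notMem fun i hi => by simpa using hcov i hi
    simp [this]
  | cons K Ks ih =>
    have hM' : Masked Ks := fun L hL => hM L (List.mem_cons_of_mem _ hL)
    have hI' : ∀ L ∈ Ks, Independent N B L := fun L hL => hI L (List.mem_cons_of_mem _ hL)
    by_cases h : ∃ v ∈ T, v ∈ K.2
    · obtain ⟨v, hv, hvK⟩ := h
      have hle := ih hM' hI' (hT.erase v) (fun i hi => hC i (Finset.mem_of_mem_erase hi))
        (hT.cover_erase (hI K List.mem_cons_self) hcov hv hvK)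
      rw [Finset.card_erase_of_mem hv] at hle
      have hne : Nat.beq (K.1 &&& C) 0 = false :=
        Bool.eq_false_iff.2 fun h => land_ne_zero ((hM K List.mem_cons_self v).2 hvK) (hC v hv)
          (Nat.eq_of_beq_eq_true h)
      simp only [countMeeting, hne, cond_false]
      omega
    · have := ih hM' hI' hT hC (cover_tail hcov h)
      simp only [countMeeting]
      omega

theorem card_le_of_search {N B k C : ℕ} {Ks : List (ℕ × List ℕ)} (h : search N B Ks C k = true)
    (hM : Masked Ks) (hI : ∀ K ∈ Ks, Independent N B K) {T : Finset ℕ} (hT : Clique N B T)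
    (hC : ∀ i ∈ T, C.testBit i = true) (hcov : ∀ i ∈ T, ∃ K ∈ Ks, i ∈ K.2) : T.card ≤ k := by
  induction Ks generalizing T C k with
  | nil =>
    have : T = ∅ := Finset.eq_empty_of_forall_notMem fun i hi => by simpa using hcov i hi
    simp [this]
  | cons K Ks ih =>
    rw [search.eq_def, Bool.or_eq_true] at h
    rcases h with h | h
    · exact (card_le_countMeeting hM hI hT hC hcov).trans (Nat.le_of_ble_eq_true h)
    have hM' : Masked Ks := fun L hL => hM L (List.mem_cons_of_mem _ hL)
    have hI' : ∀ L ∈ Ks, Independent N B L := fun L hL => hI L (List.mem_cons_of_mem _ hL)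
    cases k with
    | zero => simp at h
    | succ k =>
      simp only [Bool.and_eq_true, List.all_eq_true, Bool.or_eq_true, force_eq] at h
      by_cases hv : ∃ v ∈ T, v ∈ K.2
      · obtain ⟨v, hv, hvK⟩ := hv
        have hs := (h.1 v hvK).resolve_left fun h =>
          land_ne_zero (hC v hv) (Nat.testBit_two_pow_self (n := v)) (Nat.eq_of_beq_eq_true h)
        have hle := ih hs hM' hI' (hT.erase v) (fun i hi => by
            obtain ⟨hne, hi⟩ := Finset.mem_erase.1 hi
            simp [scramble, Nat.testBit_or, hC i hi, hT v hv i hi hne.symm])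
          (hT.cover_erase (hI K List.mem_cons_self) hcov hv hvK)
        rw [Finset.card_erase_of_mem hv] at hle
        omega
      · exact ih h.2 hM' hI' hT hC (cover_tail hcov hv)

theorem testBit_foldr_lor {Ks : List (ℕ × List ℕ)} {m i : ℕ}
    (h : (Ks.foldr (fun K m => K.1 ||| m) m).testBit i = true) :
    m.testBit i = true ∨ ∃ K ∈ Ks, K.1.testBit i = true := by
  induction Ks with
  | nil => exact Or.inl h
  | cons K Ks ih =>
    simp only [List.foldr_cons, Nat.testBit_or, Bool.or_eq_true] at h
    rcases h with h | h
    · exact Or.inr ⟨K, List.mem_cons_self, h⟩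
    · exact (ih h).imp_right fun ⟨L, hL, hi⟩ => ⟨L, List.mem_cons_of_mem _ hL, hi⟩

theorem card_le_of_certifyGraph {ι : Type*} {N B k : ℕ} {cs : List (List ℕ)}
    (h : certifyGraph N B k cs = true) (F : Finset ι) (g : ι → ℕ)
    (hg : ∀ e ∈ F, 64 ≤ g e ∧ g e < N)
    (hadj : ∀ e ∈ F, ∀ f ∈ F, e ≠ f → B.testBit (N * g e + g f) = true) : F.card ≤ k := by
  rw [certifyGraph, mapThen_eq (h := fun l => (bits l, l)) fun _ _ => force_eq _ _] at h
  set Ks := cs.map fun l => (bits l, l) with hKs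
  simp only [Bool.and_eq_true, List.all_eq_true] at h
  obtain ⟨⟨hcov, hI⟩, hs⟩ := h
  have hM : Masked Ks := by
    intro K hK i
    obtain ⟨l, -, rfl⟩ := List.mem_map.1 hK
    exact testBit_bits l i
  have hI' : ∀ K ∈ Ks, Independent N B K := by
    intro K hK i hi j hj hij
    refine land_ne_zero (i := j) ?_ ((hM K hK j).2 hj)
      (Nat.eq_of_beq_eq_true (List.all_eq_true.1 (hI K hK) i hi))
    simpa using hij
  have hcov' : ∀ i, 64 ≤ i → i < N → ∃ K ∈ Ks, i ∈ K.2 := by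
    intro i h64 hN
    have hb : (Ks.foldr (fun (K : ℕ × List ℕ) m => K.1 ||| m) (2 ^ 64 - 1)).testBit i = true := by
      rw [Nat.eq_of_beq_eq_true hcov, Nat.testBit_two_pow_sub_one]
      exact decide_eq_true hN
    rcases testBit_foldr_lor hb with hb | ⟨K, hK, hi⟩
    · rw [Nat.testBit_two_pow_sub_one] at hb
      exact absurd (of_decide_eq_true hb) h64.not_gt
    · exact ⟨K, hK, (hM K hK i).1 hi⟩
  have hinj : Set.InjOn g F := by
    intro e he f hf hef
    by_contra hne
    obtain ⟨K, hK, hi⟩ := hcov' _ (hg e he).1 (hg e he).2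
    have := hadj e he f hf hne
    rw [← hef] at this
    exact hI' K hK _ hi _ hi this
  classical
  rw [← Finset.card_image_of_injOn hinj]
  refine card_le_of_search hs hM hI' ?_ ?_ ?_
  · intro i hi j hj hij
    obtain ⟨e, he, rfl⟩ := Finset.mem_image.1 hi
    obtain ⟨f, hf, rfl⟩ := Finset.mem_image.1 hj
    exact hadj e he f hf fun h => hij (h ▸ rfl)
  · intro i hi
    obtain ⟨e, he, rfl⟩ := Finset.mem_image.1 hi
    rw [Nat.testBit_two_pow_sub_one]
    exact decide_eq_true (hg e he).2
  · intro i hi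
    obtain ⟨e, he, rfl⟩ := Finset.mem_image.1 hi
    exact hcov' _ (hg e he).1 (hg e he).2

/-! ### The crossing graph -/

theorem pairs_map {α β : Type} (h : α → β) (l : List α) :
    pairs (l.map h) = (pairs l).map (Prod.map h h) := by
  induction l with
  | nil => rfl
  | cons a l ih => simp [pairs, ih, Function.comp_def]

theorem mem_of_mem_pairs {α : Type} {l : List α} {e : α × α} (h : e ∈ pairs l) :
    e.1 ∈ l ∧ e.2 ∈ l := by
  induction l with
  | nil => simp [pairs] at h
  | cons a l ih =>
    simp only [pairs, List.mem_append, List.mem_map] at h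
    rcases h with ⟨b, hb, rfl⟩ | h
    · simp [hb]
    · simp [ih h]

theorem mem_pairs_or {α : Type} {l : List α} {a b : α} (ha : a ∈ l) (hb : b ∈ l) (hne : a ≠ b) :
    (a, b) ∈ pairs l ∨ (b, a) ∈ pairs l := by
  induction l with
  | nil => simp at ha
  | cons c l ih =>
    simp only [pairs, List.mem_append, List.mem_map, List.mem_cons] at *
    rcases ha with rfl | ha <;> rcases hb with rfl | hb
    · exact absurd rfl hne
    · exact Or.inl (Or.inl ⟨b, hb, rfl⟩)
    · exact Or.inr (Or.inl ⟨a, ha, rfl⟩)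
    · exact (ih ha hb).imp Or.inr Or.inr

theorem testBit_starsLeft {a b : ℕ × ℕ} {Q : List Vertex} {c : Vertex} {i : ℕ} (hc : c ∈ Q)
    (hl : left a b c.pt = true) (hi : c.star.testBit i = true) :
    (starsLeft a b Q).testBit i = true := by
  induction Q with
  | nil => simp at hc
  | cons d Q ih =>
    rcases List.mem_cons.1 hc with rfl | hc
    · simp [starsLeft, hl, Nat.testBit_or, hi]
    · cases h : left a b d.pt <;> simp [starsLeft, h, Nat.testBit_or, ih hc]

theorem testBit_row {l : List (ℕ × ℕ)} {e f : (ℕ × ℕ) × (ℕ × ℕ)} {j : ℕ}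
    (hj : (pairs l)[j]? = some f) (hef : splits e f = true) (hfe : splits f e = true) :
    (row (l.map (vertex (pairs l))) (Prod.map (vertex (pairs l)) (vertex (pairs l)) e)).testBit j
      = true := by
  have hf := mem_of_mem_pairs (List.mem_of_getElem? hj)
  have star₁ : (vertex (pairs l) f.1).star.testBit j = true :=
    testBit_mask hj (by simp [hasEndpoint])
  have star₂ : (vertex (pairs l) f.2).star.testBit j = true :=
    testBit_mask hj (by simp [hasEndpoint])
  have onLeft : ∀ p, left f.1 f.2 p = true → (vertex (pairs l) p).onLeft.testBit j = true :=
    fun p hp => testBit_mask hj hp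
  have onRight : ∀ p, left f.2 f.1 p = true → (vertex (pairs l) p).onRight.testBit j = true :=
    fun p hp => testBit_mask hj hp
  have stars : ∀ a b c, c ∈ l → left a b c = true →
      (vertex (pairs l) c).star.testBit j = true →
      (starsLeft a b (l.map (vertex (pairs l)))).testBit j = true :=
    fun a b c hc hl hi => testBit_starsLeft (List.mem_map_of_mem hc) hl hi
  simp only [splits, Bool.or_eq_true, Bool.and_eq_true] at hef hfe
  simp only [row, Nat.testBit_and, Nat.testBit_or, Bool.and_eq_true, Bool.or_eq_true, Prod.map]
  refine ⟨hfe.imp (fun h => ⟨onLeft _ h.1, onRight _ h.2⟩)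
    (fun h => ⟨onRight _ h.1, onLeft _ h.2⟩), ?_⟩
  rcases hef with h | h
  · exact ⟨stars _ _ _ hf.1 h.1 star₁, stars _ _ _ hf.2 h.2 star₂⟩
  · exact ⟨stars _ _ _ hf.2 h.2 star₂, stars _ _ _ hf.1 h.1 star₁⟩

theorem card_le_of_certify {ι : Type*} {k : ℕ} {l : List (ℕ × ℕ)} {cs : List (List ℕ)}
    (h : certify k l cs = true) (F : Finset ι) (s : ι → (ℕ × ℕ) × (ℕ × ℕ))
    (hs : ∀ e ∈ F, s e ∈ pairs l)
    (hsplit : ∀ e ∈ F, ∀ f ∈ F, e ≠ f → splits (s e) (s f) = true) : F.card ≤ k := by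
  rw [certify, force_eq, mapThen_eq (h := vertex (pairs l))
    (fun _ _ => by simp only [withVertex, force_eq, vertex]), force_eq] at h
  have hex : ∀ e, ∃ i : ℕ, e ∈ F → (pairs l)[i]? = some (s e) := by
    intro e
    by_cases he : e ∈ F
    · obtain ⟨i, hi⟩ := List.mem_iff_getElem?.1 (hs e he)
      exact ⟨i, fun _ => hi⟩
    · exact ⟨0, fun h => absurd h he⟩
  choose g hg using hex
  refine card_le_of_certifyGraph h F (fun e => 64 + g e) (fun e he => ?_) fun e he f hf hne => ?_
  · have := (List.getElem?_eq_some_iff.1 (hg e he)).1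
    omega
  · set N := 64 + (pairs l).length
    have := testBit_pack (N := N) (i := g e) (j := g f)
      (l := (pairs (l.map (vertex (pairs l)))).map (row (l.map (vertex (pairs l)))))
      (by rw [pairs_map, List.map_map, List.getElem?_map, hg e he]; rfl)
      (testBit_row (hg f hf) (hsplit e he f hf hne) (hsplit f hf e he hne.symm))
    have hle : N * 64 + 64 ≤ N * (64 + g e) + (64 + g f) := by nlinarith
    have hsub : N * (64 + g e) + (64 + g f) - (N * 64 + 64) = N * g e + g f := by
      rw [Nat.mul_add]; omega
    simp [Nat.testBit_shiftLeft, hle, hsub, this]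

/-! ### Geometry -/

/-- Twice the signed area of the triangle `pqr`. -/
def det (p q r : ℝ × ℝ) : ℝ :=
  (q.1 - p.1) * (r.2 - p.2) - (q.2 - p.2) * (r.1 - p.1)

theorem det_swap (p q r : ℝ × ℝ) : det q p r = -det p q r := by
  unfold det; ring

theorem det_eq_zero_of_collinear {p q r : ℝ × ℝ} (h : Collinear ℝ ({p, q, r} : Set (ℝ × ℝ))) :
    det p q r = 0 := by
  obtain ⟨v, hv⟩ := (collinear_iff_of_mem (p₀ := p) (by simp)).1 h
  obtain ⟨a, rfl⟩ := hv q (by simp)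
  obtain ⟨b, rfl⟩ := hv r (by simp)
  simp [det]
  ring

theorem det_mul_neg_of_crosses {S : Set (ℝ × ℝ)}
    (hS : ∀ p ∈ S, ∀ q ∈ S, ∀ r ∈ S, p ≠ q → p ≠ r → q ≠ r → det p q r ≠ 0)
    {p q r s : ℝ × ℝ} (hp : p ∈ S) (hq : q ∈ S) (hr : r ∈ S) (hs : s ∈ S) (hpq : p ≠ q)
    (hrs : r ≠ s) (h : Crosses p q r s) : det p q r * det p q s < 0 := by
  obtain ⟨x, ⟨c, d, -, -, hcd, hx⟩, ⟨a, b, ha, hb, hab, hx'⟩, hsing⟩ := h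
  have key : a * det p q r + b * det p q s = 0 := by
    have e₁ : a * r.1 + b * s.1 = c * p.1 + d * q.1 := by
      simpa using congrArg Prod.fst (hx'.trans hx.symm)
    have e₂ : a * r.2 + b * s.2 = c * p.2 + d * q.2 := by
      simpa using congrArg Prod.snd (hx'.trans hx.symm)
    obtain rfl : b = 1 - a := by linarith
    obtain rfl : d = 1 - c := by linarith
    unfold det
    linear_combination (q.1 - p.1) * e₂ - (q.2 - p.2) * e₁
  by_cases h0 : det p q r = 0
  · have h1 : det p q s = 0 := by
      rw [h0, mul_zero, zero_add] at key
      exact (mul_eq_zero.1 key).resolve_left hb.ne'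
    have hr' : r = p ∨ r = q := by
      by_contra! hne
      exact hS p hp q hq r hr hpq hne.1.symm hne.2.symm h0
    have hs' : s = p ∨ s = q := by
      by_contra! hne
      exact hS p hp q hq s hs hpq hne.1.symm hne.2.symm h1
    have hseg : segment ℝ r s = segment ℝ p q := by
      rcases hr' with rfl | rfl <;> rcases hs' with rfl | rfl
      · exact absurd rfl hrs
      · rfl
      · exact segment_symm ℝ _ _
      · exact absurd rfl hrs
    rw [hseg, Set.inter_self] at hsing
    have hpx : p = x := by simpa [hsing] using left_mem_segment ℝ p q
    have hqx : q = x := by simpa [hsing] using right_mem_segment ℝ p q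
    exact absurd (hpx.trans hqx.symm) hpq
  · have h2 : 0 < a * (det p q r * det p q r) := mul_pos ha (mul_self_pos.2 h0)
    have h3 : b * (det p q r * det p q s) = -(a * (det p q r * det p q r)) := by
      linear_combination det p q r * key
    exact (pos_iff_neg_of_mul_neg (a := b) (by linarith)).1 hb

/-- The embedding of the grid into the plane. -/
def toPlane (p : ℕ × ℕ) : ℝ × ℝ := (p.1, p.2)

theorem toPlane_injective : Function.Injective toPlane := by
  intro p q h
  simpa [toPlane, Prod.ext_iff] using h

theorem left_eq_true_iff {a b c : ℕ × ℕ} :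
    left a b c = true ↔ 0 < det (toPlane a) (toPlane b) (toPlane c) := by
  have h : left a b c = true ↔ a.2 * b.1 + (b.2 * c.1 + c.2 * a.1) <
      a.1 * b.2 + (b.1 * c.2 + c.1 * a.2) := iff_of_eq Nat.ble_eq
  rw [h, ← Nat.cast_lt (α := ℝ), ← sub_pos]
  push_cast
  rw [iff_iff_eq]
  congr 1
  simp only [det, toPlane]
  ring

theorem det_ne_zero_of_generalPosition {l : List (ℕ × ℕ)} (h : generalPosition l = true)
    {a b c : ℕ × ℕ} (ha : a ∈ l) (hb : b ∈ l) (hc : c ∈ l) (hab : a ≠ b) (hac : a ≠ c)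
    (hbc : b ≠ c) : det (toPlane a) (toPlane b) (toPlane c) ≠ 0 := by
  have key : ∀ a b, (a, b) ∈ pairs l → a ≠ c → b ≠ c →
      det (toPlane a) (toPlane b) (toPlane c) ≠ 0 := by
    intro a b hab hac hbc h0
    have h1 := List.all_eq_true.1 (List.all_eq_true.1 h _ hab) c hc
    simp only [Bool.or_eq_true, left_eq_true_iff, det_swap (toPlane a), h0] at h1
    simp only [hasEndpoint, neg_zero, lt_irrefl, or_false, Bool.or_eq_true, Bool.and_eq_true,
      Nat.beq_eq] at h1
    rcases h1 with h1 | h1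
    · exact hac (Prod.ext h1.1.symm h1.2.symm)
    · exact hbc (Prod.ext h1.1.symm h1.2.symm)
  rcases mem_pairs_or ha hb hab with h | h
  · exact key a b h hac hbc
  · rw [det_swap, neg_ne_zero]
    exact key b a h hbc hac

theorem splits_of_det_mul_neg {e f : (ℕ × ℕ) × (ℕ × ℕ)}
    (h : det (toPlane e.1) (toPlane e.2) (toPlane f.1) *
      det (toPlane e.1) (toPlane e.2) (toPlane f.2) < 0) : splits e f = true := by
  simp only [splits, Bool.or_eq_true, Bool.and_eq_true, left_eq_true_iff,
    det_swap (toPlane e.1) (toPlane e.2), neg_pos]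
  exact mul_neg_iff.1 h

/-- The endpoints of `e` are those of the grid segment `s`. -/
def SameSegment (e : (ℝ × ℝ) × (ℝ × ℝ)) (s : (ℕ × ℕ) × (ℕ × ℕ)) : Prop :=
  e = (toPlane s.1, toPlane s.2) ∨ e = (toPlane s.2, toPlane s.1)

theorem SameSegment.crosses {e f : (ℝ × ℝ) × (ℝ × ℝ)} {s t : (ℕ × ℕ) × (ℕ × ℕ)}
    (hs : SameSegment e s) (ht : SameSegment f t) (h : Crosses e.1 e.2 f.1 f.2) :
    Crosses (toPlane s.1) (toPlane s.2) (toPlane t.1) (toPlane t.2) := by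
  unfold Crosses at *
  rcases hs with rfl | rfl <;> rcases ht with rfl | rfl <;>
    simpa only [openSegment_symm ℝ (toPlane s.2), openSegment_symm ℝ (toPlane t.2),
      segment_symm ℝ (toPlane s.2), segment_symm ℝ (toPlane t.2)] using h

open Classical in
/-- The set of points of the plane listed in `l`. -/
noncomputable def pointSet (l : List (ℕ × ℕ)) : Finset (ℝ × ℝ) := l.toFinset.image toPlane

theorem mem_pointSet {l : List (ℕ × ℕ)} {p : ℝ × ℝ} :
    p ∈ pointSet l ↔ ∃ a ∈ l, toPlane a = p := by
  simp [pointSet]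

theorem card_pointSet {l : List (ℕ × ℕ)} (h : l.Nodup) : (pointSet l).card = l.length := by
  rw [pointSet, Finset.card_image_of_injective _ toPlane_injective, List.toFinset_card_of_nodup h]

theorem det_ne_zero_of_mem_pointSet {l : List (ℕ × ℕ)} (h : generalPosition l = true) :
    ∀ p ∈ pointSet l, ∀ q ∈ pointSet l, ∀ r ∈ pointSet l, p ≠ q → p ≠ r → q ≠ r →
      det p q r ≠ 0 := by
  intro p hp q hq r hr hpq hpr hqr
  obtain ⟨a, ha, rfl⟩ := mem_pointSet.1 hp
  obtain ⟨b, hb, rfl⟩ := mem_pointSet.1 hq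
  obtain ⟨c, hc, rfl⟩ := mem_pointSet.1 hr
  exact det_ne_zero_of_generalPosition h ha hb hc (ne_of_apply_ne _ hpq) (ne_of_apply_ne _ hpr)
    (ne_of_apply_ne _ hqr)

theorem genPos_pointSet {l : List (ℕ × ℕ)} (h : generalPosition l = true) :
    GenPos (pointSet l) :=
  fun p hp q hq r hr hpq hpr hqr hcol =>
    det_ne_zero_of_mem_pointSet h p hp q hq r hr hpq hpr hqr (det_eq_zero_of_collinear hcol)

theorem card_crossingFamily_le {k : ℕ} {l : List (ℕ × ℕ)} {cs : List (List ℕ)}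
    (hl : generalPosition l = true) (h : certify k l cs = true)
    {F : Finset ((ℝ × ℝ) × (ℝ × ℝ))} (hF : IsCrossingFamily (pointSet l) F) : F.card ≤ k := by
  obtain ⟨hmem, hcross⟩ := hF
  have hex : ∀ e, ∃ s, e ∈ F → s ∈ pairs l ∧ SameSegment e s := by
    intro e
    by_cases he : e ∈ F
    · obtain ⟨h1, h2, hne⟩ := hmem e he
      obtain ⟨a, ha, hae⟩ := mem_pointSet.1 h1
      obtain ⟨b, hb, hbe⟩ := mem_pointSet.1 h2
      have hab : a ≠ b := fun hab => hne (by rw [← hae, ← hbe, hab])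
      rcases mem_pairs_or ha hb hab with hp | hp
      · exact ⟨_, fun _ => ⟨hp, Or.inl (by rw [hae, hbe])⟩⟩
      · exact ⟨_, fun _ => ⟨hp, Or.inr (by rw [hae, hbe])⟩⟩
    · exact ⟨((0, 0), (0, 0)), fun h => absurd h he⟩
  choose s hs using hex
  have hs_mem : ∀ e ∈ F, toPlane (s e).1 ∈ pointSet l ∧ toPlane (s e).2 ∈ pointSet l ∧
      toPlane (s e).1 ≠ toPlane (s e).2 := by
    intro e he
    have := hmem e he
    rcases (hs e he).2 with h | h <;> rw [h] at this
    · exact this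
    · exact ⟨this.2.1, this.1, this.2.2.symm⟩
  refine card_le_of_certify h F s (fun e he => (hs e he).1) fun e he f hf hne => ?_
  obtain ⟨he₁, he₂, he₃⟩ := hs_mem e he
  obtain ⟨hf₁, hf₂, hf₃⟩ := hs_mem f hf
  exact splits_of_det_mul_neg (det_mul_neg_of_crosses (S := pointSet l)
    (det_ne_zero_of_mem_pointSet hl) he₁ he₂ hf₁ hf₂ he₃ hf₃
    ((hs e he).2.crosses (hs f hf).2 (hcross e he f hf hne)))

/-! ### The point set -/

/-- The witness: 29 points with natural coordinates. -/
def points : List (ℕ × ℕ) :=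
  [(3396, 4371), (2364, 4375), (2030, 2559), (3949, 3714), (568, 7192), (1792, 1278),
   (6044, 4211), (3180, 4387), (5839, 4209), (3912, 4268), (2820, 4123), (998, 0), (4991, 4306),
   (908, 6754), (2326, 2689), (3374, 4135), (2168, 5688), (1159, 182), (2867, 4478), (49, 7916),
   (401, 7347), (5841, 4208), (1675, 930), (2986, 3939), (4948, 4280), (2952, 4691), (1177, 317),
   (5769, 4203), (0, 7968)]

/-- A partition of the 406 segments of `points` into twelve sets of pairwise non-crossing segments.
A segment is given by 64 plus its position in `pairs points`. -/
def classes : List (List ℕ) :=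
  [ [67, 103, 107, 116, 121, 126, 133, 149, 163, 180, 181, 183, 190, 198, 240, 246, 263, 267,
      268, 270, 273, 274, 275, 279, 301, 306, 310, 311, 344, 356, 373, 407, 416, 431, 439, 448,
      449, 455],
    [85, 87, 142, 167, 178, 179, 189, 191, 202, 211, 255, 266, 277, 350, 361, 368, 385, 387,
      399, 429, 437, 446, 456, 460, 463, 467],
    [71, 84, 135, 136, 152, 158, 162, 164, 177, 199, 207, 247, 291, 293, 327, 334, 340, 341,
      360, 379, 381, 443],
    [65, 69, 77, 95, 101, 118, 123, 215, 217, 219, 244, 260, 284, 316, 364, 365, 453],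
    [76, 83, 129, 154, 195, 242, 253, 257, 299, 323, 347, 388, 395, 432, 440, 461],
    [90, 187, 201, 204, 223, 239, 252, 258, 264, 276, 304, 357, 358, 366, 398, 427, 435],
    [188, 225, 250, 308, 314, 320, 342, 376, 380, 382, 384, 391, 396, 413, 424, 436, 444, 445,
      457, 459],
    [66, 93, 124, 128, 140, 145, 148, 151, 153, 157, 159, 160, 161, 166, 169, 196, 209, 251,
      265, 289, 298, 335, 351, 374, 383, 438, 442, 469],
    [73, 112, 134, 138, 147, 155, 174, 182, 206, 213, 220, 224, 233, 261, 271, 280, 283, 286,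
      290, 295, 300, 309, 312, 315, 353, 362, 372, 375, 390, 392, 393, 397, 401, 405, 406, 418,
      426, 434, 451, 458],
    [74, 81, 89, 94, 104, 109, 110, 144, 165, 175, 184, 197, 203, 214, 226, 228, 235, 237, 269,
      281, 287, 288, 292, 294, 296, 307, 319, 328, 329, 339, 355, 359, 369, 370, 378, 389, 394,
      410, 415, 417, 419, 420, 423, 428, 430, 450, 462],
    [64, 70, 75, 79, 82, 88, 91, 96, 97, 98, 99, 100, 102, 105, 108, 111, 113, 114, 117, 119,
      120, 122, 125, 130, 131, 137, 139, 143, 150, 168, 170, 172, 193, 194, 208, 216, 218, 222,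
      227, 232, 234, 236, 249, 259, 297, 303, 337, 349, 354, 371, 377, 386, 403, 414, 433, 441,
      447, 452, 454, 466, 468],
    [68, 72, 78, 80, 86, 92, 106, 115, 127, 132, 141, 146, 156, 171, 173, 176, 185, 186, 192,
      200, 205, 210, 212, 221, 229, 230, 231, 238, 241, 243, 245, 248, 254, 256, 262, 272, 278,
      282, 285, 302, 305, 313, 317, 318, 321, 322, 324, 325, 326, 330, 331, 332, 333, 336, 338,
      343, 345, 346, 348, 352, 363, 367, 400, 402, 404, 408, 409, 411, 412, 421, 422, 425, 464,
      465] ]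

/-! ### Verification -/

theorem nodup_points : points.Nodup := by
  decide +kernel

set_option maxRecDepth 100000 in
theorem generalPosition_points : generalPosition points = true := by
  decide +kernel

set_option maxRecDepth 100000 in
theorem certify_points : certify 6 points classes = true := by
  decide +kernel

end CrossingFamily

/-- There exists a set of 29 points in the plane in general position that
contains no 7-crossing family. -/
theorem exists_29_points_without_7_crossing_family :
    ∃ S : Finset (ℝ × ℝ), S.card = 29 ∧ GenPos S ∧ ¬ HasCrossingFamily S 7 := by
  exact ⟨CrossingFamily.pointSet CrossingFamily.points,
    CrossingFamily.card_pointSet CrossingFamily.nodup_points,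
    CrossingFamily.genPos_pointSet CrossingFamily.generalPosition_points,
    fun ⟨F, hF, hcard⟩ => by
      have := CrossingFamily.card_crossingFamily_le CrossingFamily.generalPosition_points
        CrossingFamily.certify_points hF
      omega⟩
end
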